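/- arXiv:1408.3931 — 2 statements merged into one kernel-verified Lean document; each statement's English description precedes it below -/
import Mathlib

section
/- Fix p ∈ (0,1) and let h₂(p) = −p·log₂ p − (1 − p)·log₂(1 − p) be the binary entropy of p. For each n, let C_n be a finite nonempty set of nonempty binary strings, let P_n be a probability mass function on C_n, and let Q_p be the Bernoulli(p)-induced distribution on strings. Write E_n = Σ_{c ∈ C_n} P_n(c)·ℓ(c) for the expected length, H(P_n) = −Σ_{c ∈ supp P_n} P_n(c)·log₂ P_n(c) for the entropy, and D_n = Σ_{c ∈ supp P_n} P_n(c)·log₂(P_n(c)/Q_p(c)) for the informational divergence. If E_n → ∞ and D_n/E_n → 0 as n → ∞, then |H(P_n)/E_n − h₂(p)| → 0 as n → ∞; that is, the entropy rate of the output converges to the entropy of the target distribution. -/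
/-- The Bernoulli(`p`)-induced distribution on binary strings:
`Q_p(c) = ∏_{i=1}^{ℓ(c)} q(c_i)` with `q(0) = p` and `q(1) = 1 − p`,
where bit `0` is encoded as `false` and bit `1` as `true`. -/
def bernoulliString (p : ℝ) (c : List Bool) : ℝ :=
  (c.map (fun b => if b then 1 - p else p)).prod

/-- The binary entropy function `h₂(p) = −p·log₂ p − (1 − p)·log₂ (1 − p)`. -/
noncomputable def binEntropy (p : ℝ) : ℝ :=
  -p * Real.logb 2 p - (1 - p) * Real.logb 2 (1 - p)

/-- product weight of a binary string -/
def wtStr (u v : ℝ) (c : List Bool) : ℝ :=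
  (c.map (fun b => if b then v else u)).prod

lemma wtStr_pos {u v : ℝ} (hu : 0 < u) (hv : 0 < v) (c : List Bool) : 0 < wtStr u v c := by
  induction c with
  | nil => simp [wtStr]
  | cons b c ih =>
    have : wtStr u v (b :: c) = (if b then v else u) * wtStr u v c := by simp [wtStr]
    rw [this]
    cases b <;> simp <;> positivity

lemma log_wtStr {u v : ℝ} (hu : 0 < u) (hv : 0 < v) (c : List Bool) :
    Real.log (wtStr u v c) = (c.count false : ℝ) * Real.log u
      + ((c.length : ℝ) - c.count false) * Real.log v := by
  induction c with
  | nil => simp [wtStr]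
  | cons b c ih =>
    have : wtStr u v (b :: c) = (if b then v else u) * wtStr u v c := by simp [wtStr]
    have hp := wtStr_pos hu hv c
    rw [this]
    cases b
    · simp only [Bool.false_eq_true, if_false]
      rw [Real.log_mul hu.ne' hp.ne', ih]
      simp
      ring
    · simp only [if_true]
      rw [Real.log_mul hv.ne' hp.ne', ih]
      simp
      ring

/-- all binary strings of length at most `n` -/
def allStr : ℕ → Finset (List Bool)
  | 0 => {[]}
  | n + 1 => insert [] ((allStr n).image (List.cons false) ∪ (allStr n).image (List.cons true))

lemma mem_allStr (n : ℕ) : ∀ c : List Bool, c.length ≤ n → c ∈ allStr n := by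
  induction n with
  | zero => intro c hc; simp at hc; simp [allStr, hc]
  | succ n ih =>
    intro c hc
    cases c with
    | nil => simp [allStr]
    | cons b c =>
      have := ih c (by simpa using hc)
      cases b <;> simp [allStr, this]

lemma sum_allStr {u v : ℝ} (hu : 0 < u) (hv : 0 < v) (hs : u + v < 1) (n : ℕ) :
    ∑ c ∈ allStr n, wtStr u v c ≤ 1 / (1 - (u + v)) := by
  have h1 : 0 < 1 - (u + v) := by linarith
  induction n with
  | zero =>
    simp only [allStr, Finset.sum_singleton]
    rw [le_div_iff₀ h1]
    simp [wtStr]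
    linarith
  | succ n ih =>
    have hnn : ∀ c, 0 ≤ wtStr u v c := fun c => (wtStr_pos hu hv c).le
    have e1 : ∑ c ∈ (allStr n).image (List.cons false), wtStr u v c
        = u * ∑ c ∈ allStr n, wtStr u v c := by
      rw [Finset.sum_image (by intro a _ b _ h; simpa using h), Finset.mul_sum]
      simp [wtStr]
    have e2 : ∑ c ∈ (allStr n).image (List.cons true), wtStr u v c
        = v * ∑ c ∈ allStr n, wtStr u v c := by
      rw [Finset.sum_image (by intro a _ b _ h; simpa using h), Finset.mul_sum]
      simp [wtStr]
    have e3 := Finset.sum_union_inter (s₁ := (allStr n).image (List.cons false))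
      (s₂ := (allStr n).image (List.cons true)) (f := wtStr u v)
    have e4 : 0 ≤ ∑ c ∈ (allStr n).image (List.cons false) ∩ (allStr n).image (List.cons true),
      wtStr u v c := Finset.sum_nonneg (fun c _ => hnn c)
    have e5 : wtStr u v [] = 1 := by simp [wtStr]
    rw [allStr, Finset.sum_insert (by simp), e5]
    have e6 : (u + v) * ∑ c ∈ allStr n, wtStr u v c ≤ (u + v) * (1 / (1 - (u + v))) :=
      mul_le_mul_of_nonneg_left ih (by linarith)
    have e7 : 1 + (u + v) * (1 / (1 - (u + v))) = 1 / (1 - (u + v)) := by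
      field_simp
      ring
    linarith

lemma sum_wtStr {u v : ℝ} (hu : 0 < u) (hv : 0 < v) (hs : u + v < 1) (S : Finset (List Bool)) :
    ∑ c ∈ S, wtStr u v c ≤ 1 / (1 - (u + v)) := by
  refine le_trans ?_ (sum_allStr hu hv hs (S.sup List.length))
  apply Finset.sum_le_sum_of_subset_of_nonneg
  · intro c hc
    exact mem_allStr _ c (Finset.le_sup (f := List.length) hc)
  · intro c _ _
    exact (wtStr_pos hu hv c).le

lemma exp_le_quad {t : ℝ} (ht : |t| ≤ 1) : Real.exp t ≤ 1 + t + t ^ 2 := by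
  have := Real.abs_exp_sub_one_sub_id_le ht
  have := (abs_le.1 this).2
  linarith

lemma tilt_lt {p δ : ℝ} (hp0 : 0 < p) (hp1 : p < 1) (hδ : δ ≠ 0) (hδ1 : |δ| ≤ 1) :
    p * Real.exp (δ * (1 - p) - δ ^ 2) + (1 - p) * Real.exp (-(δ * p) - δ ^ 2) < 1 := by
  have hq : 0 < 1 - p := by linarith
  have h1 : Real.exp (δ * (1 - p)) ≤ 1 + δ * (1 - p) + (δ * (1 - p)) ^ 2 := by
    apply exp_le_quad
    rw [abs_mul, abs_of_pos hq]
    nlinarith [abs_nonneg δ]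
  have h2 : Real.exp (-(δ * p)) ≤ 1 + -(δ * p) + (-(δ * p)) ^ 2 := by
    apply exp_le_quad
    rw [abs_neg, abs_mul, abs_of_pos hp0]
    nlinarith [abs_nonneg δ]
  have hd : 0 < δ ^ 2 := by positivity
  have h3 : δ ^ 2 + 1 < Real.exp (δ ^ 2) := Real.add_one_lt_exp hd.ne'
  have h4 : p * Real.exp (δ * (1 - p)) + (1 - p) * Real.exp (-(δ * p)) ≤ 1 + δ ^ 2 := by
    have a := mul_le_mul_of_nonneg_left h1 hp0.le
    have b := mul_le_mul_of_nonneg_left h2 hq.le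
    have c : p * (1 - p) ≤ 1 := by nlinarith
    have d := mul_le_mul_of_nonneg_left c hd.le
    nlinarith
  rw [Real.exp_sub, Real.exp_sub, ← mul_div_assoc, ← mul_div_assoc, ← add_div,
    div_lt_one (Real.exp_pos _)]
  linarith

lemma key_bound {p δ : ℝ} (hp0 : 0 < p) (hp1 : p < 1) (hδ : δ ≠ 0) (hδ1 : |δ| ≤ 1) :
    ∃ K : ℝ, ∀ (S : Finset (List Bool)) (P : List Bool → ℝ), (∀ c ∈ S, 0 < P c) →
      δ * (∑ c ∈ S, P c * (c.count false : ℝ) - p * ∑ c ∈ S, P c * (c.length : ℝ))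
        - δ ^ 2 * ∑ c ∈ S, P c * (c.length : ℝ) - K
      ≤ ∑ c ∈ S, P c * Real.log (P c / wtStr p (1 - p) c) := by
  have hq : 0 < 1 - p := by linarith
  set u := p * Real.exp (δ * (1 - p) - δ ^ 2) with hu
  set v := (1 - p) * Real.exp (-(δ * p) - δ ^ 2) with hv
  have hu0 : 0 < u := by positivity
  have hv0 : 0 < v := by positivity
  have hs : u + v < 1 := tilt_lt hp0 hp1 hδ hδ1
  refine ⟨1 / (1 - (u + v)), fun S P hP => ?_⟩
  have hW := sum_wtStr hu0 hv0 hs S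
  have hlu : Real.log u = Real.log p + (δ * (1 - p) - δ ^ 2) := by
    rw [hu, Real.log_mul hp0.ne' (Real.exp_pos _).ne', Real.log_exp]
  have hlv : Real.log v = Real.log (1 - p) + (-(δ * p) - δ ^ 2) := by
    rw [hv, Real.log_mul hq.ne' (Real.exp_pos _).ne', Real.log_exp]
  have hterm : ∀ c ∈ S, δ * (P c * (c.count false : ℝ) - p * (P c * (c.length : ℝ)))
        - δ ^ 2 * (P c * (c.length : ℝ)) - wtStr u v c
        ≤ P c * Real.log (P c / wtStr p (1 - p) c) := by
    intro c hc
    have hPc := hP c hc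
    have w1 := wtStr_pos hu0 hv0 c
    have w2 := wtStr_pos hp0 hq c
    have l1 := log_wtStr hu0 hv0 c
    have l2 := log_wtStr hp0 hq c
    rw [Real.log_div hPc.ne' w2.ne']
    have g := Real.log_le_sub_one_of_pos (div_pos w1 hPc)
    rw [Real.log_div w1.ne' hPc.ne'] at g
    have g2 := mul_le_mul_of_nonneg_left g hPc.le
    have g3 : P c * (wtStr u v c / P c - 1) = wtStr u v c - P c := by
      field_simp
    rw [g3, l1, hlu, hlv] at g2
    rw [l2]
    nlinarith
  have := Finset.sum_le_sum hterm
  simp only [Finset.sum_sub_distrib, ← Finset.mul_sum] at this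
  linarith

/-- Proposition 2 of the paper: for a sequence of codebooks `C n` of nonempty binary
strings with pmfs `P n`, if the expected lengths `E n` tend to infinity and the
normalized divergences `D n / E n` tend to zero, then the entropy rate `H(P n) / E n`
converges to the binary entropy `h₂(p)` of the target distribution. -/
theorem adm_entropy_rate_converges (p : ℝ) (hp0 : 0 < p) (hp1 : p < 1)
    (C : ℕ → Finset (List Bool)) (hC : ∀ n, (C n).Nonempty)
    (hne : ∀ n, ∀ c ∈ C n, c ≠ [])
    (P : ℕ → List Bool → ℝ)
    (hPnn : ∀ n, ∀ c ∈ C n, 0 ≤ P n c) (hPsum : ∀ n, ∑ c ∈ C n, P n c = 1)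
    (E H D : ℕ → ℝ)
    (hE : ∀ n, E n = ∑ c ∈ C n, P n c * (c.length : ℝ))
    (hH : ∀ n, H n = -∑ c ∈ (C n).filter (fun c => 0 < P n c),
      P n c * Real.logb 2 (P n c))
    (hD : ∀ n, D n = ∑ c ∈ (C n).filter (fun c => 0 < P n c),
      P n c * Real.logb 2 (P n c / bernoulliString p c))
    (hEtop : Filter.Tendsto E Filter.atTop Filter.atTop)
    (hDE : Filter.Tendsto (fun n => D n / E n) Filter.atTop (nhds 0)) :
    Filter.Tendsto (fun n => |H n / E n - binEntropy p|) Filter.atTop (nhds 0) := by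
  have hq : 0 < 1 - p := by linarith
  have hfil : ∀ n (f : List Bool → ℝ), ∑ c ∈ (C n).filter (fun c => 0 < P n c), P n c * f c
      = ∑ c ∈ C n, P n c * f c := by
    intro n f
    apply Finset.sum_subset (Finset.filter_subset _ _)
    intro c hc hc'
    have h0 : ¬ 0 < P n c := fun h => hc' (Finset.mem_filter.2 ⟨hc, h⟩)
    have : P n c = 0 := le_antisymm (not_lt.1 h0) (hPnn n c hc)
    simp [this]
  have hpos : ∀ n, ∀ c ∈ (C n).filter (fun c => 0 < P n c), 0 < P n c :=
    fun n c hc => (Finset.mem_filter.1 hc).2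
  have hbw : ∀ c, bernoulliString p c = wtStr p (1 - p) c := fun c => rfl
  set N : ℕ → ℝ := fun n => ∑ c ∈ C n, P n c * (c.count false : ℝ) with hN
  have hl2 : 0 < Real.log 2 := Real.log_pos (by norm_num)
  have hDlog : ∀ n, D n * Real.log 2 = ∑ c ∈ (C n).filter (fun c => 0 < P n c),
      P n c * Real.log (P n c / wtStr p (1 - p) c) := by
    intro n
    rw [hD, Finset.sum_mul]
    refine Finset.sum_congr rfl fun c _ => ?_
    rw [hbw, mul_assoc, Real.logb, div_mul_cancel₀ _ hl2.ne']
  have hHD : ∀ n, H n = - D n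
      - (N n * Real.logb 2 p + (E n - N n) * Real.logb 2 (1 - p)) := by
    intro n
    have e : N n * Real.logb 2 p + (E n - N n) * Real.logb 2 (1 - p)
        = ∑ c ∈ (C n).filter (fun c => 0 < P n c), P n c * Real.logb 2 (wtStr p (1 - p) c) := by
      rw [hfil, hE]
      simp only [hN]
      rw [← Finset.sum_sub_distrib, Finset.sum_mul, Finset.sum_mul, ← Finset.sum_add_distrib]
      refine Finset.sum_congr rfl fun c _ => ?_
      simp only [Real.logb]
      rw [log_wtStr hp0 hq]
      ring
    rw [e, hH, hD, ← Finset.sum_neg_distrib, ← Finset.sum_neg_distrib, ← Finset.sum_sub_distrib]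
    refine Finset.sum_congr rfl fun c hc => ?_
    rw [hbw, Real.logb_div (hpos n c hc).ne' (wtStr_pos hp0 hq c).ne']
    ring
  have hkey : ∀ δ : ℝ, δ ≠ 0 → |δ| ≤ 1 →
      ∀ᶠ n in Filter.atTop, δ * (N n / E n - p) < 2 * δ ^ 2 := by
    intro δ hδ hδ1
    obtain ⟨K, hK⟩ := key_bound hp0 hp1 hδ hδ1
    have hlim : Filter.Tendsto (fun n => D n / E n * Real.log 2 + K / E n) Filter.atTop
        (nhds (0 * Real.log 2 + 0)) :=
      (hDE.mul_const _).add (hEtop.const_div_atTop K)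
    have hd : 0 * Real.log 2 + 0 < δ ^ 2 := by
      have : 0 < δ ^ 2 := by positivity
      simpa using this
    filter_upwards [hlim.eventually_lt_const hd, hEtop.eventually_gt_atTop 0] with n h1 h2
    have h3 := hK _ (P n) (hpos n)
    rw [← hDlog, hfil, hfil, ← hE] at h3
    change δ * (N n - p * E n) - δ ^ 2 * E n - K ≤ _ at h3
    have h4 : δ * (N n / E n - p) - δ ^ 2 ≤ D n / E n * Real.log 2 + K / E n := by
      have a : δ * (N n / E n - p) - δ ^ 2 = (δ * (N n - p * E n) - δ ^ 2 * E n) / E n := by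
        field_simp
      have b : D n / E n * Real.log 2 + K / E n = (D n * Real.log 2 + K) / E n := by
        field_simp
      rw [a, b]
      exact div_le_div_of_nonneg_right (by linarith) h2.le
    linarith
  have hx : Filter.Tendsto (fun n => N n / E n) Filter.atTop (nhds p) := by
    rw [Metric.tendsto_atTop']
    intro ε hε
    set δ := min 1 (ε / 2) with hδd
    have hδ : 0 < δ := by positivity
    have hδ1 : δ ≤ 1 := min_le_left _ _
    have hδ2 : δ ≤ ε / 2 := min_le_right _ _
    have k1 := hkey δ hδ.ne' (by rwa [abs_of_pos hδ])
    have k2 := hkey (-δ) (by simpa using hδ.ne') (by rwa [abs_neg, abs_of_pos hδ])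
    obtain ⟨M, hM⟩ := Filter.eventually_atTop.1 (k1.and k2)
    refine ⟨M, fun n hn => ?_⟩
    obtain ⟨a, b⟩ := hM n hn.le
    rw [Real.dist_eq, abs_lt]
    have a' : δ * (N n / E n - p) < δ * (2 * δ) := by linarith [a, pow_two δ]
    have b' : δ * (-(N n / E n - p)) < δ * (2 * δ) := by nlinarith [b]
    have a'' := lt_of_mul_lt_mul_left a' hδ.le
    have b'' := lt_of_mul_lt_mul_left b' hδ.le
    constructor <;> linarith
  have hfin : Filter.Tendsto (fun n => -(D n / E n) - (N n / E n * Real.logb 2 p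
      + (1 - N n / E n) * Real.logb 2 (1 - p)) - binEntropy p) Filter.atTop
      (nhds (-0 - (p * Real.logb 2 p + (1 - p) * Real.logb 2 (1 - p)) - binEntropy p)) :=
    (hDE.neg.sub ((hx.mul_const _).add ((hx.const_sub 1).mul_const _))).sub_const _
  have hz : -0 - (p * Real.logb 2 p + (1 - p) * Real.logb 2 (1 - p)) - binEntropy p = 0 := by
    unfold binEntropy
    ring
  rw [hz] at hfin
  have habs := hfin.abs
  rw [abs_zero] at habs
  refine habs.congr' ?_
  filter_upwards [hEtop.eventually_gt_atTop 0] with n hn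
  congr 2
  rw [hHD]
  field_simp
end

section
/- Fix p ∈ (0,1) with binary entropy h₂(p) = −p·log₂ p − (1 − p)·log₂(1 − p), and fix a real h_S > 0. For each n ≥ 1, let C_n be a finite nonempty set of nonempty binary strings, let P_n be a probability mass function on C_n with entropy H(P_n) = n·h_S, let E_n = Σ_{c ∈ C_n} P_n(c)·ℓ(c) be the expected length, and let D_n be the informational divergence of P_n from the Bernoulli(p)-induced distribution Q_p on C_n. If E_n → ∞ and D_n/E_n → 0 as n → ∞, then the conversion rate satisfies |n/E_n − h₂(p)/h_S| → 0 as n → ∞. -/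
theorem adm_kraft (a b : ℝ) (hab : Real.exp a + Real.exp b < 1) :
    ∀ (L : ℕ), ∃ T : Finset (List Bool), (∀ c : List Bool, c.length ≤ L → c ∈ T) ∧
      ∑ c ∈ T, Real.exp ((c.count false : ℝ) * a + (c.count true : ℝ) * b)
        ≤ 1 / (1 - (Real.exp a + Real.exp b)) := by
  have hpos : 0 < 1 - (Real.exp a + Real.exp b) := by linarith
  have hs : 0 < Real.exp a + Real.exp b := by positivity
  intro L
  induction L with
  | zero =>
    refine ⟨{[]}, ?_, ?_⟩
    · intro c hc
      simpa using hc
    · rw [le_div_iff₀ hpos]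
      simp
      linarith
  | succ L ih =>
    obtain ⟨T, hT, hsum⟩ := ih
    refine ⟨insert [] (T.image (List.cons false) ∪ T.image (List.cons true)), ?_, ?_⟩
    · intro c hc
      rcases c with _ | ⟨x, c⟩
      · simp
      · have : c ∈ T := hT c (by simpa using hc)
        cases x <;> simp [this]
    · rw [Finset.sum_insert (by simp), Finset.sum_union, Finset.sum_image (by simp),
        Finset.sum_image (by simp)]
      · have h1 : ∀ c : List Bool, Real.exp (((false :: c).count false : ℝ) * a +
            ((false :: c).count true : ℝ) * b)
            = Real.exp a * Real.exp ((c.count false : ℝ) * a + (c.count true : ℝ) * b) := by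
          intro c
          rw [← Real.exp_add]
          simp
          ring
        have h2 : ∀ c : List Bool, Real.exp (((true :: c).count false : ℝ) * a +
            ((true :: c).count true : ℝ) * b)
            = Real.exp b * Real.exp ((c.count false : ℝ) * a + (c.count true : ℝ) * b) := by
          intro c
          rw [← Real.exp_add]
          simp
          ring
        simp only [h1, h2, ← Finset.mul_sum]
        rw [← add_mul]
        have h3 := mul_le_mul_of_nonneg_left hsum hs.le
        have h4 : 1 + (Real.exp a + Real.exp b) * (1 / (1 - (Real.exp a + Real.exp b)))
            = 1 / (1 - (Real.exp a + Real.exp b)) := by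
          field_simp
          ring
        simp only [List.count_nil, Nat.cast_zero, zero_mul, add_zero, Real.exp_zero]
        linarith
      · rw [Finset.disjoint_left]
        intro c hc hc'
        simp only [Finset.mem_image] at hc hc'
        obtain ⟨x, _, rfl⟩ := hc
        obtain ⟨y, _, h⟩ := hc'
        simp at h

theorem adm_kraft' (a b : ℝ) (hab : Real.exp a + Real.exp b < 1) (C : Finset (List Bool)) :
    ∑ c ∈ C, Real.exp ((c.count false : ℝ) * a + (c.count true : ℝ) * b)
        ≤ 1 / (1 - (Real.exp a + Real.exp b)) := by
  obtain ⟨T, hT, h⟩ := adm_kraft a b hab (C.sup List.length)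
  refine le_trans (Finset.sum_le_sum_of_subset_of_nonneg ?_ ?_) h
  · intro c hc
    exact hT c (Finset.le_sup (f := List.length) hc)
  · intros
    positivity

theorem adm_bern (p : ℝ) (hp0 : 0 < p) (hp1 : p < 1) (c : List Bool) :
    0 < bernoulliString p c ∧ Real.log (bernoulliString p c) =
      (c.count false : ℝ) * Real.log p + (c.count true : ℝ) * Real.log (1 - p) := by
  have hq : 0 < 1 - p := by linarith
  induction c with
  | nil => simp [bernoulliString]
  | cons x c ih =>
    obtain ⟨h1, h2⟩ := ih
    have e : bernoulliString p (x :: c) = (if x then 1 - p else p) * bernoulliString p c := by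
      simp [bernoulliString]
    rw [e]
    cases x
    · simp only [Bool.false_eq_true, if_false]
      refine ⟨by positivity, ?_⟩
      rw [Real.log_mul hp0.ne' h1.ne', h2]
      simp
      ring
    · simp only [if_true]
      refine ⟨by positivity, ?_⟩
      rw [Real.log_mul hq.ne' h1.ne', h2]
      simp
      ring

theorem adm_tilt (p : ℝ) (hp0 : 0 < p) (hp1 : p < 1) (t : ℝ) (ht : t ≠ 0) (ht1 : |t| ≤ 1) :
    Real.exp (Real.log p + t * (1 - p) - t ^ 2)
      + Real.exp (Real.log (1 - p) - t * p - t ^ 2) < 1 := by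
  have hq : 0 < 1 - p := by linarith
  have key : ∀ y : ℝ, |y| ≤ 1 → Real.exp y ≤ 1 + y + y ^ 2 := by
    intro y hy
    have := Real.abs_exp_sub_one_sub_id_le hy
    have := (abs_le.mp this).2
    linarith
  have k1 := key (t * (1 - p)) (by
    rw [abs_mul, abs_of_pos hq]
    nlinarith [abs_nonneg t])
  have k2 := key (-(t * p)) (by
    rw [abs_neg, abs_mul, abs_of_pos hp0]
    nlinarith [abs_nonneg t])
  have e1 : Real.exp (Real.log p + t * (1 - p) - t ^ 2)
      = p * Real.exp (t * (1 - p)) * Real.exp (-t ^ 2) := by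
    rw [sub_eq_add_neg, Real.exp_add, Real.exp_add, Real.exp_log hp0]
  have e2 : Real.exp (Real.log (1 - p) - t * p - t ^ 2)
      = (1 - p) * Real.exp (-(t * p)) * Real.exp (-t ^ 2) := by
    rw [sub_eq_add_neg, sub_eq_add_neg, Real.exp_add, Real.exp_add, Real.exp_log hq]
  have ht2 : 0 < t ^ 2 := by positivity
  have k3 : 1 + t ^ 2 < Real.exp (t ^ 2) := by
    have := Real.add_one_lt_exp ht2.ne'
    linarith
  have k4 : p * Real.exp (t * (1 - p)) + (1 - p) * Real.exp (-(t * p)) ≤ 1 + t ^ 2 := by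
    have m1 := mul_le_mul_of_nonneg_left k1 hp0.le
    have m2 := mul_le_mul_of_nonneg_left k2 hq.le
    have : p * (1 - p) * t ^ 2 ≤ 1 * t ^ 2 :=
      mul_le_mul_of_nonneg_right (by nlinarith) ht2.le
    nlinarith
  rw [e1, e2, ← add_mul]
  calc _ < Real.exp (t ^ 2) * Real.exp (-t ^ 2) :=
        mul_lt_mul_of_pos_right (lt_of_le_of_lt k4 k3) (Real.exp_pos _)
    _ = 1 := by rw [← Real.exp_add]; simp

/-- Gibbs-type inequality. -/
theorem adm_gibbs (a b : ℝ) (hab : Real.exp a + Real.exp b < 1) (S : Finset (List Bool))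
    (P : List Bool → ℝ) (hP : ∀ c ∈ S, 0 < P c) :
    (∑ c ∈ S, P c * (c.count false : ℝ)) * a + (∑ c ∈ S, P c * (c.count true : ℝ)) * b
      - ∑ c ∈ S, P c * Real.log (P c) ≤ 1 / (1 - (Real.exp a + Real.exp b)) := by
  refine le_trans ?_ (adm_kraft' a b hab S)
  rw [Finset.sum_mul, Finset.sum_mul, ← Finset.sum_add_distrib, ← Finset.sum_sub_distrib]
  refine Finset.sum_le_sum fun c hc => ?_
  have h := hP c hc
  set y := (c.count false : ℝ) * a + (c.count true : ℝ) * b with hy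
  have h1 := Real.add_one_le_exp (y - Real.log (P c))
  rw [Real.exp_sub, Real.exp_log h, le_div_iff₀ h] at h1
  have : P c * ↑(c.count false) * a + P c * ↑(c.count true) * b = P c * y := by
    rw [hy]; ring
  rw [this]
  nlinarith

/-- Conversion-rate consequence of Proposition 2: if for each `n ≥ 1` the pmf `P n` on
the codebook `C n` has entropy `H(P n) = n·h_S`, the expected lengths `E n` tend to
infinity and the normalized divergences `D n / E n` tend to zero, then the conversion
rate satisfies `|n / E n − h₂(p)/h_S| → 0`. -/
theorem adm_conversion_rate_converges (p : ℝ) (hp0 : 0 < p) (hp1 : p < 1)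
    (hS : ℝ) (hhS : 0 < hS)
    (C : ℕ → Finset (List Bool)) (hC : ∀ n, 1 ≤ n → (C n).Nonempty)
    (hne : ∀ n, 1 ≤ n → ∀ c ∈ C n, c ≠ [])
    (P : ℕ → List Bool → ℝ)
    (hPnn : ∀ n, 1 ≤ n → ∀ c ∈ C n, 0 ≤ P n c)
    (hPsum : ∀ n, 1 ≤ n → ∑ c ∈ C n, P n c = 1)
    (E D : ℕ → ℝ)
    (hE : ∀ n, 1 ≤ n → E n = ∑ c ∈ C n, P n c * (c.length : ℝ))
    (hH : ∀ n, 1 ≤ n → -∑ c ∈ (C n).filter (fun c => 0 < P n c),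
      P n c * Real.logb 2 (P n c) = (n : ℝ) * hS)
    (hD : ∀ n, 1 ≤ n → D n = ∑ c ∈ (C n).filter (fun c => 0 < P n c),
      P n c * Real.logb 2 (P n c / bernoulliString p c))
    (hEtop : Filter.Tendsto E Filter.atTop Filter.atTop)
    (hDE : Filter.Tendsto (fun n => D n / E n) Filter.atTop (nhds 0)) :
    Filter.Tendsto (fun (n : ℕ) => |(n : ℝ) / E n - binEntropy p / hS|)
      Filter.atTop (nhds 0) := by
  have hq : 0 < 1 - p := by linarith
  have hl2 : 0 < Real.log 2 := Real.log_pos (by norm_num)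
  obtain ⟨S, hSdef⟩ : ∃ S : ℕ → Finset (List Bool),
      ∀ n, S n = (C n).filter (fun c => 0 < P n c) := ⟨_, fun _ => rfl⟩
  have hSP : ∀ n, ∀ c ∈ S n, 0 < P n c := by
    intro n c hc
    rw [hSdef] at hc
    exact (Finset.mem_filter.mp hc).2
  obtain ⟨M, hM⟩ : ∃ M : ℕ → ℝ, ∀ n, M n = ∑ c ∈ S n, P n c * (c.count false : ℝ) :=
    ⟨_, fun _ => rfl⟩
  obtain ⟨K, hK⟩ : ∃ K : ℕ → ℝ, ∀ n, K n = ∑ c ∈ S n, P n c * (c.count true : ℝ) :=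
    ⟨_, fun _ => rfl⟩
  obtain ⟨G, hG⟩ : ∃ G : ℕ → ℝ, ∀ n, G n = ∑ c ∈ S n, P n c * Real.log (P n c) :=
    ⟨_, fun _ => rfl⟩
  have hEMK : ∀ n, 1 ≤ n → E n = M n + K n := by
    intro n hn
    rw [hE n hn, hM, hK, ← Finset.sum_add_distrib, hSdef, Finset.sum_filter]
    refine Finset.sum_congr rfl fun c hc => ?_
    split_ifs with h
    · have : c.length = c.count false + c.count true := by
        have := List.count_not_add_count c true
        simpa using this.symm
      rw [this]
      push_cast
      ring
    · have : P n c = 0 := le_antisymm (not_lt.mp h) (hPnn n hn c hc)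
      simp [this]
  have hHG : ∀ n : ℕ, 1 ≤ n → (n : ℝ) * hS * Real.log 2 = - G n := by
    intro n hn
    rw [← hH n hn, hG, hSdef, neg_mul, Finset.sum_mul]
    congr 1
    refine Finset.sum_congr rfl fun c _ => ?_
    rw [Real.logb]
    field_simp
  have hDG : ∀ n, 1 ≤ n → D n * Real.log 2
      = G n - (M n * Real.log p + K n * Real.log (1 - p)) := by
    intro n hn
    rw [hD n hn, ← hSdef, hG, hM, hK, Finset.sum_mul, Finset.sum_mul, Finset.sum_mul,
      ← Finset.sum_add_distrib, ← Finset.sum_sub_distrib]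
    refine Finset.sum_congr rfl fun c hc => ?_
    obtain ⟨b1, b2⟩ := adm_bern p hp0 hp1 c
    rw [Real.logb, Real.log_div (hSP n c hc).ne' b1.ne', b2]
    field_simp
  have bound : ∀ t : ℝ, t ≠ 0 → |t| ≤ 1 → ∃ B : ℝ, ∀ n, 1 ≤ n →
      t * (M n - p * E n) - t ^ 2 * E n - D n * Real.log 2 ≤ B := by
    intro t ht ht1
    refine ⟨_, fun n hn => le_trans (le_of_eq ?_)
      (adm_gibbs _ _ (adm_tilt p hp0 hp1 t ht ht1) (S n) (P n) (hSP n))⟩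
    rw [← hM, ← hK, ← hG, hDG n hn, hEMK n hn]
    ring
  have hx : Filter.Tendsto (fun n => M n / E n) Filter.atTop (nhds p) := by
    rw [Metric.tendsto_atTop']
    intro ε hε
    obtain ⟨τ, hτ0, hτ1, hτε⟩ : ∃ τ : ℝ, 0 < τ ∧ τ ≤ 1 ∧ τ ≤ ε / 2 :=
      ⟨min 1 (ε / 2), by positivity, min_le_left _ _, min_le_right _ _⟩
    obtain ⟨B1, hB1⟩ := bound τ hτ0.ne' (by rwa [abs_of_pos hτ0])
    obtain ⟨B2, hB2⟩ := bound (-τ) (neg_ne_zero.mpr hτ0.ne') (by rwa [abs_neg, abs_of_pos hτ0])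
    have l1 : ∀ B : ℝ, Filter.Tendsto (fun n => D n / E n * Real.log 2 + B / E n)
        Filter.atTop (nhds 0) := by
      intro B
      have := (hDE.mul_const (Real.log 2)).add (hEtop.const_div_atTop B)
      simpa using this
    have hτε' : 0 < τ * (ε / 2) := by positivity
    have ev := (((l1 B1).eventually_lt_const hτε').and ((l1 B2).eventually_lt_const hτε')).and
      ((hEtop.eventually_gt_atTop 0).and (Filter.eventually_ge_atTop 1))
    obtain ⟨N, hN⟩ := Filter.eventually_atTop.mp ev
    refine ⟨N, fun n hn => ?_⟩
    obtain ⟨⟨h1, h2⟩, hE0, hn1⟩ := hN n (le_of_lt hn)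
    have c1 := hB1 n hn1
    have c2 := hB2 n hn1
    obtain ⟨x, hx⟩ : ∃ x, x = M n / E n := ⟨_, rfl⟩
    obtain ⟨d, hd⟩ : ∃ d, d = D n / E n := ⟨_, rfl⟩
    have hMx : M n = x * E n := by rw [hx]; field_simp
    have hDd : D n = d * E n := by rw [hd]; field_simp
    have c1' : τ * (x - p) - τ ^ 2 - d * Real.log 2 ≤ B1 / E n := by
      rw [le_div_iff₀ hE0]
      rw [hMx, hDd] at c1
      linarith
    have c2' : -τ * (x - p) - τ ^ 2 - d * Real.log 2 ≤ B2 / E n := by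
      rw [le_div_iff₀ hE0]
      rw [hMx, hDd] at c2
      linarith
    rw [← hx, Real.dist_eq, abs_lt]
    rw [← hd] at h1 h2
    constructor
    · have : τ * (-(x - p)) < τ * ε := by nlinarith
      have := lt_of_mul_lt_mul_left this hτ0.le
      linarith
    · have : τ * (x - p) < τ * ε := by nlinarith
      exact lt_of_mul_lt_mul_left this hτ0.le
  have hlim : Filter.Tendsto (fun n => (-(D n / E n * Real.log 2) - M n / E n * Real.log p
      - (1 - M n / E n) * Real.log (1 - p)) / (hS * Real.log 2)) Filter.atTop
      (nhds ((-(0 * Real.log 2) - p * Real.log p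
      - (1 - p) * Real.log (1 - p)) / (hS * Real.log 2))) :=
    ((((hDE.mul_const _).neg.sub (hx.mul_const _)).sub
      ((hx.const_sub 1).mul_const _)).div_const _)
  have hval : (-(0 * Real.log 2) - p * Real.log p
      - (1 - p) * Real.log (1 - p)) / (hS * Real.log 2) = binEntropy p / hS := by
    simp only [binEntropy, Real.logb]
    field_simp
    ring
  rw [hval] at hlim
  have hfin : Filter.Tendsto (fun n : ℕ => (n : ℝ) / E n) Filter.atTop
      (nhds (binEntropy p / hS)) := by
    refine hlim.congr' ?_
    filter_upwards [hEtop.eventually_gt_atTop 0, Filter.eventually_ge_atTop 1] with n hE0 hn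
    have a1 := hHG n hn
    have a2 := hDG n hn
    have a3 := hEMK n hn
    have a4 : K n = E n - M n := by linarith
    rw [a4] at a2
    rw [div_eq_div_iff (by positivity) hE0.ne']
    field_simp
    linarith
  have := (hfin.sub_const (binEntropy p / hS)).abs
  simpa using this
end
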